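/- Let n ≥ 3 and 2−n < γ < 0. There exists a constant C > 0, depending only on n and γ, such that for every continuously differentiable u : ℝⁿ₊ → ℝ, every y ∈ ℝⁿ₊, and every R ≥ max(1, 2|y|), one has ∫_{S⁺_R} φ(x,y) |⟨x/|x|, ∇u(x)⟩| dH^{n−1}(x) ≤ C · R^γ · sup_{x ∈ ℝⁿ₊} ρ(x)^{−γ+1}|∇u(x)|. -/

import Mathlib

open MeasureTheory Metric Filter
open scoped ENNReal Topology

noncomputable section

/-- The closed half-space `{x : x k ≥ 0}`, where `k` is the distinguished (last) coordinate. -/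
def upperHalf (n : ℕ) (k : Fin n) : Set (EuclideanSpace ℝ (Fin n)) := {x | 0 ≤ x k}

/-- The reflection `ȳ` of `y` across the hyperplane `{x k = 0}`. -/
def reflOf (n : ℕ) (k : Fin n) (y : EuclideanSpace ℝ (Fin n)) : EuclideanSpace ℝ (Fin n) :=
  y - (2 * y k) • EuclideanSpace.single k 1

/-- The Green kernel `φ(x, y) = |x - y|^{2-n} + |x - ȳ|^{2-n}` of the half-space. -/
def greenKer (n : ℕ) (k : Fin n) (x y : EuclideanSpace ℝ (Fin n)) : ℝ :=
  ‖x - y‖ ^ ((2 : ℝ) - n) + ‖x - reflOf n k y‖ ^ ((2 : ℝ) - n)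

section HausdorffSphere

open Module
open scoped InnerProductSpace Pointwise

variable {E : Type*} [NormedAddCommGroup E] [InnerProductSpace ℝ E] [MeasurableSpace E]
  [BorelSpace E]

/-- A closed hemisphere of the unit sphere has finite surface measure. -/
theorem hausdorffMeasure_hemisphere_lt_top (d : ℕ) [Fact (finrank ℝ E = d + 1)] {v : E}
    (hv : ‖v‖ = 1) : μH[d] ({x : E | ⟪v, x⟫_ℝ ≤ 0} ∩ sphere 0 1) < ∞ := by
  have : FiniteDimensional ℝ E := FiniteDimensional.of_fact_finrank_eq_succ d
  have hv0 : v ≠ 0 := by rintro rfl; simp at hv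
  have hrank : finrank ℝ (ℝ ∙ v)ᗮ = d := Submodule.finrank_orthogonal_span_singleton hv0
  let f : (ℝ ∙ v)ᗮ → E := fun w => stereoInvFunAux v w
  have hf : ContDiff ℝ 1 f := contDiff_stereoInvFunAux.comp (ℝ ∙ v)ᗮ.subtypeL.contDiff
  obtain ⟨K, hK⟩ := hf.contDiffOn.exists_lipschitzOnWith one_ne_zero
    (convex_closedBall (0 : (ℝ ∙ v)ᗮ) 2) (isCompact_closedBall _ _)
  have hsub : {x : E | ⟪v, x⟫_ℝ ≤ 0} ∩ sphere 0 1 ⊆ f '' closedBall 0 2 := by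
    rintro x ⟨hx, hxs⟩
    simp only [Set.mem_ofPred_eq] at hx
    have hx1 : ‖x‖ = 1 := by simpa using hxs
    have hxv : x ≠ v := by
      rintro rfl
      rw [real_inner_self_eq_norm_sq, hx1] at hx
      norm_num at hx
    refine ⟨stereoToFun v x, ?_, congrArg Subtype.val (stereo_left_inv hv (x := ⟨x, hxs⟩) hxv)⟩
    rw [mem_closedBall_zero_iff, stereoToFun_apply, norm_smul, innerSL_apply_apply,
      Real.norm_eq_abs, abs_of_pos (by apply div_pos <;> linarith)]
    have h1 : 2 / (1 - ⟪v, x⟫_ℝ) ≤ 2 := div_le_self zero_le_two (by linarith)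
    have h2 := (ℝ ∙ v)ᗮ.norm_orthogonalProjectionOnto_apply_le x
    rw [hx1] at h2
    exact (mul_le_mul h1 h2 (norm_nonneg _) zero_le_two).trans_eq (mul_one 2)
  refine (measure_mono hsub).trans_lt <|
    (hK.hausdorffMeasure_image_le (Nat.cast_nonneg d)).trans_lt ?_
  rw [ENNReal.rpow_natCast]
  refine ENNReal.mul_lt_top (ENNReal.pow_lt_top ENNReal.coe_lt_top) ?_
  rw [← hrank]
  exact (isCompact_closedBall _ _).measure_lt_top

/-- The unit sphere has finite surface measure. -/
theorem hausdorffMeasure_unitSphere_lt_top (d : ℕ) [Fact (finrank ℝ E = d + 1)] :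
    μH[d] (sphere (0 : E) 1) < ∞ := by
  have : Nontrivial E := nontrivial_of_finrank_pos (R := ℝ) (by
    rw [Fact.out (p := finrank ℝ E = d + 1)]; omega)
  obtain ⟨v, hv⟩ := exists_norm_eq E zero_le_one
  refine (measure_mono (t := ({x : E | ⟪v, x⟫_ℝ ≤ 0} ∩ sphere 0 1) ∪
    ({x : E | ⟪-v, x⟫_ℝ ≤ 0} ∩ sphere 0 1)) fun x hx => ?_).trans_lt (measure_union_lt_top
      (hausdorffMeasure_hemisphere_lt_top d hv)
      (hausdorffMeasure_hemisphere_lt_top d ((norm_neg v).trans hv)))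
  rcases le_total ⟪v, x⟫_ℝ 0 with h | h
  · exact Or.inl ⟨h, hx⟩
  · exact Or.inr ⟨by simpa using h, hx⟩

/-- The surface measure of spheres centred at the origin scales with the radius. -/
theorem hausdorffMeasure_sphere_zero {d : ℝ} (hd : 0 ≤ d) {R : ℝ} (hR : 0 < R) :
    μH[d] (sphere (0 : E) R) = ENNReal.ofReal (R ^ d) * μH[d] (sphere (0 : E) 1) := by
  have h : sphere (0 : E) R = R • sphere (0 : E) 1 := by
    rw [smul_sphere' hR.ne', smul_zero, Real.norm_of_nonneg hR.le, mul_one]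
  rw [h, Measure.hausdorffMeasure_smul₀ hd hR.ne', ENNReal.smul_def, smul_eq_mul,
    ENNReal.coe_rpow_of_nonneg _ hd, ← ENNReal.ofReal_rpow_of_pos hR]
  congr 2
  rw [← enorm_eq_nnnorm, Real.enorm_of_nonneg hR.le]

end HausdorffSphere

theorem norm_reflOf {n : ℕ} (k : Fin n) (y : EuclideanSpace ℝ (Fin n)) :
    ‖reflOf n k y‖ = ‖y‖ := by
  rw [← sq_eq_sq₀ (norm_nonneg _) (norm_nonneg _), reflOf, norm_sub_sq_real, norm_smul,
    inner_smul_right, EuclideanSpace.inner_single_right]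
  simp [mul_pow]
  ring

/-- Away from its poles the Green kernel is controlled by the distance to the origin. -/
theorem greenKer_le {n : ℕ} (hn : 3 ≤ n) (k : Fin n) {x y : EuclideanSpace ℝ (Fin n)}
    (hx : 0 < ‖x‖) (hxy : 2 * ‖y‖ ≤ ‖x‖) :
    greenKer n k x y ≤ 2 * (‖x‖ / 2) ^ ((2 : ℝ) - n) := by
  have hn' : (3 : ℝ) ≤ n := mod_cast hn
  have key : ∀ z : EuclideanSpace ℝ (Fin n), ‖z‖ = ‖y‖ →
      ‖x - z‖ ^ ((2 : ℝ) - n) ≤ (‖x‖ / 2) ^ ((2 : ℝ) - n) := fun z hz =>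
    Real.rpow_le_rpow_of_nonpos (by linarith) (by linarith [norm_sub_norm_le x z]) (by linarith)
  rw [greenKer, two_mul]
  exact add_le_add (key y rfl) (key _ (norm_reflOf k y))

/-- for `n ≥ 3` and `2 - n < γ < 0` there is `C = C(n, γ) > 0` such that for
every `C¹` function `u` on `ℝⁿ₊`, every `y ∈ ℝⁿ₊` and every `R ≥ max(1, 2|y|)`,
`∫_{S⁺_R} φ(x,y) |⟨x/|x|, ∇u(x)⟩| dH^{n-1}(x) ≤ C R^γ · sup_{ℝⁿ₊} ρ^{-γ+1}|∇u|`
(stated with an arbitrary upper bound `M` for the weighted gradient). -/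
theorem stmt_8 (n : ℕ) (hn : 3 ≤ n) (γ : ℝ) (hγ₁ : 2 - (n : ℝ) < γ) (hγ₂ : γ < 0) :
    ∃ C : ℝ, 0 < C ∧
      ∀ u : EuclideanSpace ℝ (Fin n) → ℝ,
        ContDiffOn ℝ 1 u (upperHalf n ⟨n - 1, by omega⟩) →
        ∀ y ∈ upperHalf n ⟨n - 1, by omega⟩,
          ∀ R : ℝ, max 1 (2 * ‖y‖) ≤ R →
            ∀ M : ℝ,
              (∀ x ∈ upperHalf n ⟨n - 1, by omega⟩,
                (1 + ‖x‖) ^ (-γ + 1) *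
                  ‖fderivWithin ℝ u (upperHalf n ⟨n - 1, by omega⟩) x‖ ≤ M) →
              ∫⁻ x in upperHalf n ⟨n - 1, by omega⟩ ∩ sphere 0 R,
                  ENNReal.ofReal (greenKer n ⟨n - 1, by omega⟩ x y *
                    |fderivWithin ℝ u (upperHalf n ⟨n - 1, by omega⟩) x (‖x‖⁻¹ • x)|)
                  ∂(μH[(n : ℝ) - 1]) ≤
                ENNReal.ofReal (C * R ^ γ * M) := by
  have hn' : (3 : ℝ) ≤ n := mod_cast hn
  have hcast : ((n - 1 : ℕ) : ℝ) = n - 1 := by push_cast [show 1 ≤ n by omega]; ring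
  have : Fact (Module.finrank ℝ (EuclideanSpace ℝ (Fin n)) = (n - 1) + 1) :=
    ⟨by rw [finrank_euclideanSpace_fin]; omega⟩
  have hfin := hausdorffMeasure_unitSphere_lt_top (E := EuclideanSpace ℝ (Fin n)) (n - 1)
  rw [hcast] at hfin
  set A : ℝ := (μH[(n : ℝ) - 1] (sphere (0 : EuclideanSpace ℝ (Fin n)) 1)).toReal with hA
  have hA0 : 0 ≤ A := ENNReal.toReal_nonneg
  set B : ℝ := 2 * (1 / 2 : ℝ) ^ ((2 : ℝ) - n) with hB
  have hB0 : 0 < B := by positivity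
  refine ⟨B * A + 1, by positivity, fun u _ y _ R hR M hM => ?_⟩
  obtain ⟨hR1, hRy⟩ := max_le_iff.mp hR
  have hR0 : 0 < R := by linarith
  set k : Fin n := ⟨n - 1, by omega⟩
  have hM0 : 0 ≤ M := le_trans (by positivity) (hM 0 (by simp [upperHalf]))
  have hmeas : MeasurableSet (upperHalf n k ∩ sphere 0 R) := by
    refine (isClosed_le continuous_const ?_).measurableSet.inter isClosed_sphere.measurableSet
    fun_prop
  have hpt : ∀ x ∈ upperHalf n k ∩ sphere 0 R,
      ENNReal.ofReal (greenKer n k x y * |fderivWithin ℝ u (upperHalf n k) x (‖x‖⁻¹ • x)|) ≤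
        ENNReal.ofReal (B * R ^ ((2 : ℝ) - n) * (R ^ (γ - 1) * M)) := by
    rintro x ⟨hx, hxs⟩
    have hxR : ‖x‖ = R := by simpa using hxs
    have hker : greenKer n k x y ≤ B * R ^ ((2 : ℝ) - n) := by
      refine (greenKer_le hn k (hxR ▸ hR0) (hxR ▸ hRy)).trans_eq ?_
      rw [hxR, hB, div_eq_mul_one_div, Real.mul_rpow hR0.le (by norm_num)]
      ring
    have hunit : ‖‖x‖⁻¹ • x‖ = 1 := norm_smul_inv_norm (𝕜 := ℝ) (norm_pos_iff.mp (hxR ▸ hR0))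
    have hgrad : |fderivWithin ℝ u (upperHalf n k) x (‖x‖⁻¹ • x)| ≤ R ^ (γ - 1) * M := by
      calc |fderivWithin ℝ u (upperHalf n k) x (‖x‖⁻¹ • x)|
          ≤ ‖fderivWithin ℝ u (upperHalf n k) x‖ * ‖‖x‖⁻¹ • x‖ :=
            (Real.norm_eq_abs _).symm.trans_le (ContinuousLinearMap.le_opNorm _ _)
        _ = R ^ (γ - 1) * (R ^ (-γ + 1) * ‖fderivWithin ℝ u (upperHalf n k) x‖) := by
            rw [hunit, mul_one, ← mul_assoc, ← Real.rpow_add hR0]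
            simp
        _ ≤ R ^ (γ - 1) * ((1 + ‖x‖) ^ (-γ + 1) * ‖fderivWithin ℝ u (upperHalf n k) x‖) := by
            gcongr
            · linarith
            · linarith
        _ ≤ R ^ (γ - 1) * M := by
            gcongr
            exact hM x hx
    exact ENNReal.ofReal_le_ofReal (mul_le_mul hker hgrad (abs_nonneg _) (by positivity))
  have hpow : R ^ ((2 : ℝ) - n) * R ^ (γ - 1) * R ^ ((n : ℝ) - 1) = R ^ γ := by
    rw [← Real.rpow_add hR0, ← Real.rpow_add hR0]
    congr 1
    ring
  calc _ ≤ ∫⁻ _ in upperHalf n k ∩ sphere 0 R,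
          ENNReal.ofReal (B * R ^ ((2 : ℝ) - n) * (R ^ (γ - 1) * M)) ∂(μH[(n : ℝ) - 1]) :=
        setLIntegral_mono' hmeas hpt
    _ = ENNReal.ofReal (B * R ^ ((2 : ℝ) - n) * (R ^ (γ - 1) * M)) *
          μH[(n : ℝ) - 1] (upperHalf n k ∩ sphere 0 R) := setLIntegral_const _ _
    _ ≤ ENNReal.ofReal (B * R ^ ((2 : ℝ) - n) * (R ^ (γ - 1) * M)) *
          (ENNReal.ofReal (R ^ ((n : ℝ) - 1)) * ENNReal.ofReal A) := by
        rw [hA, ENNReal.ofReal_toReal hfin.ne, ← hausdorffMeasure_sphere_zero (by linarith) hR0]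
        gcongr
        exact Set.inter_subset_right
    _ = ENNReal.ofReal (B * A * R ^ γ * M) := by
        rw [← ENNReal.ofReal_mul (by positivity), ← ENNReal.ofReal_mul (by positivity), ← hpow]
        congr 1
        ring
    _ ≤ ENNReal.ofReal ((B * A + 1) * R ^ γ * M) := by
        gcongr
        linarith
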